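/- Let p, q ∈ [1, ∞) and n ≥ 0. Then there exists a constant C_{p,q,n} such that for every real Banach space X, every m ∈ ℕ, every ξ₁, …, ξ_m in the n-th Wiener chaos 𝓗_n, and every x₁, …, x_m ∈ X, one has ‖Σ_{j=1}^m ξ_j x_j‖_{L^q(Ω;X)} ≤ C_{p,q,n} ‖Σ_{j=1}^m ξ_j x_j‖_{L^p(Ω;X)}. -/

import Mathlib

open MeasureTheory ProbabilityTheory Filter Set
open scoped ENNReal NNReal RealInnerProductSpace BigOperators

/-- The `n`-th Hermite polynomial function
`H_n(x) = ((−1)^n/n!) e^{x²/2} dⁿ/dxⁿ (e^{−x²/2})`. -/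
noncomputable def hermiteFun (n : ℕ) (x : ℝ) : ℝ :=
  ((-1 : ℝ) ^ n / n.factorial) * Real.exp (x ^ 2 / 2) *
    iteratedDeriv n (fun y => Real.exp (-(y ^ 2) / 2)) x

/-- `W` is an `H`-isonormal Gaussian process on the probability space `(Ω, P)`: a centered
Gaussian family `(W h)_{h ∈ H}` with `E[W h₁ * W h₂] = ⟪h₁, h₂⟫_H`. -/
structure IsIsonormal {H : Type*} [NormedAddCommGroup H] [InnerProductSpace ℝ H]
    {Ω : Type*} [MeasurableSpace Ω] (P : Measure Ω) (W : H → Ω → ℝ) : Prop where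
  meas : ∀ h, Measurable (W h)
  gaussian : ∀ h : H, P.map (W h) = gaussianReal 0 (‖h‖₊ ^ 2)
  cov : ∀ h₁ h₂ : H, ∫ ω, W h₁ ω * W h₂ ω ∂P = ⟪h₁, h₂⟫

/-- The `n`-th Wiener chaos of the isonormal Gaussian process `W`: the closed linear
subspace of `L²(Ω)` generated by `{H_n(W(h)) : h ∈ H, ‖h‖ = 1}`. -/
noncomputable def wienerChaos {H : Type*} [NormedAddCommGroup H] [InnerProductSpace ℝ H]
    {Ω : Type*} [MeasurableSpace Ω] (P : Measure Ω) (W : H → Ω → ℝ) (n : ℕ) :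
    Set (Lp ℝ 2 P) :=
  closure (Submodule.span ℝ
    {f : Lp ℝ 2 P | ∃ h : H, ‖h‖ = 1 ∧ ∀ᵐ ω ∂P, f ω = hermiteFun n (W h ω)} : Set (Lp ℝ 2 P))

/-- Minkowski's integral inequality in `L²`, for nonnegative functions. -/
theorem lintegral_sq_lintegral_le {A B : Type*} [MeasurableSpace A] [MeasurableSpace B]
    (μ : Measure A) (ν : Measure B) [SFinite μ] [SFinite ν] {F : A → B → ℝ≥0∞}
    (hF : Measurable (Function.uncurry F)) :
    ∫⁻ a, (∫⁻ b, F a b ∂ν) ^ 2 ∂μ ≤ (∫⁻ b, (∫⁻ a, F a b ^ 2 ∂μ) ^ (1 / 2 : ℝ) ∂ν) ^ 2 := by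
  set N : B → ℝ≥0∞ := fun b => (∫⁻ a, F a b ^ 2 ∂μ) ^ (1 / 2 : ℝ) with hN
  have hFa : ∀ b, Measurable fun a => F a b := fun b => by fun_prop
  have hFb : ∀ a, Measurable fun b => F a b := fun a => by fun_prop
  have hNm : Measurable N := by
    refine Measurable.pow_const ?_ _
    exact Measurable.lintegral_prod_left' (f := fun z : A × B => F z.1 z.2 ^ 2)
      (Measurable.pow_const hF 2)
  have key : ∀ b c, ∫⁻ a, F a b * F a c ∂μ ≤ N b * N c := by
    intro b c
    have := ENNReal.lintegral_mul_le_Lp_mul_Lq μ Real.HolderConjugate.two_two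
      (hFa b).aemeasurable (hFa c).aemeasurable
    simpa [hN] using this
  calc ∫⁻ a, (∫⁻ b, F a b ∂ν) ^ 2 ∂μ
      = ∫⁻ a, ∫⁻ b, ∫⁻ c, F a b * F a c ∂ν ∂ν ∂μ := by
        refine lintegral_congr fun a => ?_
        rw [sq, ← lintegral_mul_const _ (hFb a)]
        refine lintegral_congr fun b => ?_
        rw [lintegral_const_mul _ (hFb a)]
    _ = ∫⁻ b, ∫⁻ a, ∫⁻ c, F a b * F a c ∂ν ∂μ ∂ν := by
        refine lintegral_lintegral_swap (Measurable.aemeasurable ?_)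
        refine Measurable.lintegral_prod_right'
          (f := fun z : (A × B) × B => F z.1.1 z.1.2 * F z.1.1 z.2) ?_
        fun_prop
    _ = ∫⁻ b, ∫⁻ c, ∫⁻ a, F a b * F a c ∂μ ∂ν ∂ν := by
        refine lintegral_congr fun b => lintegral_lintegral_swap (Measurable.aemeasurable ?_)
        fun_prop
    _ ≤ ∫⁻ b, ∫⁻ c, N b * N c ∂ν ∂ν := by
        gcongr with b c
        exact key b c
    _ = (∫⁻ b, N b ∂ν) ^ 2 := by
        rw [sq, ← lintegral_mul_const _ hNm]
        refine lintegral_congr fun b => ?_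
        rw [lintegral_const_mul _ hNm]

/-- The averaging operator `f ↦ ∫ f (ρ x + σ y) dμ(y)` has norm at most one from `L²(μ)` to
`L^{2k}(μ)` on nonnegative functions. -/
def IsHypercontractive {E : Type*} [MeasurableSpace E] [AddCommGroup E] [Module ℝ E]
    (μ : Measure E) (ρ σ : ℝ) (k : ℕ) : Prop :=
  ∀ f : E → ℝ≥0∞, Measurable f →
    ∫⁻ x, (∫⁻ y, f (ρ • x + σ • y) ∂μ) ^ (2 * k) ∂μ ≤ (∫⁻ x, f x ^ 2 ∂μ) ^ k

theorem IsHypercontractive.prod {E E' : Type*} [MeasurableSpace E] [AddCommGroup E] [Module ℝ E]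
    [MeasurableAdd₂ E] [MeasurableConstSMul ℝ E]
    [MeasurableSpace E'] [AddCommGroup E'] [Module ℝ E']
    [MeasurableAdd₂ E'] [MeasurableConstSMul ℝ E']
    {μ : Measure E} {ν : Measure E'} [SFinite μ] [SFinite ν] {ρ σ : ℝ} {k : ℕ}
    (hμ : IsHypercontractive μ ρ σ k) (hν : IsHypercontractive ν ρ σ k) :
    IsHypercontractive (μ.prod ν) ρ σ k := by
  intro f hf
  set g : E' → ℝ≥0∞ := fun w => (∫⁻ x, f (x, w) ^ 2 ∂μ) ^ (1 / 2 : ℝ) with hg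
  have hgm : Measurable g := by
    refine Measurable.pow_const ?_ _
    exact Measurable.lintegral_prod_left' (f := fun z : E × E' => f z ^ 2) (hf.pow_const 2)
  have hφ : ∀ x', Measurable fun w : E => ∫⁻ y', f (w, ρ • x' + σ • y') ∂ν := by
    intro x'
    exact Measurable.lintegral_prod_right'
      (f := fun z : E × E' => f (z.1, ρ • x' + σ • z.2)) (by fun_prop)
  calc ∫⁻ x, (∫⁻ y, f (ρ • x + σ • y) ∂(μ.prod ν)) ^ (2 * k) ∂(μ.prod ν)
      = ∫⁻ x', ∫⁻ x, (∫⁻ y, ∫⁻ y', f (ρ • x + σ • y, ρ • x' + σ • y') ∂ν ∂μ) ^ (2 * k) ∂μ ∂ν := by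
        rw [lintegral_prod_symm]
        · refine lintegral_congr fun x' => lintegral_congr fun x => ?_
          rw [lintegral_prod]
          · rfl
          · exact (hf.comp (g := f) (f := fun y : E × E' => (ρ • x + σ • y.1, ρ • x' + σ • y.2))
              (by fun_prop)).aemeasurable
        · refine (Measurable.pow_const ?_ _).aemeasurable
          exact Measurable.lintegral_prod_right'
            (f := fun z : (E × E') × (E × E') =>
              f (ρ • z.1.1 + σ • z.2.1, ρ • z.1.2 + σ • z.2.2)) (by fun_prop)
    _ ≤ ∫⁻ x', (∫⁻ w, (∫⁻ y', f (w, ρ • x' + σ • y') ∂ν) ^ 2 ∂μ) ^ k ∂ν := by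
        gcongr with x'
        exact hμ _ (hφ x')
    _ ≤ ∫⁻ x', ((∫⁻ y', g (ρ • x' + σ • y') ∂ν) ^ 2) ^ k ∂ν := by
        gcongr with x'
        exact lintegral_sq_lintegral_le μ ν (F := fun w y' => f (w, ρ • x' + σ • y'))
          (by unfold Function.uncurry; fun_prop)
    _ = ∫⁻ x', (∫⁻ y', g (ρ • x' + σ • y') ∂ν) ^ (2 * k) ∂ν := by
        simp_rw [pow_mul]
    _ ≤ (∫⁻ w, g w ^ 2 ∂ν) ^ k := hν g hgm
    _ = (∫⁻ x, f x ^ 2 ∂(μ.prod ν)) ^ k := by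
        rw [lintegral_prod_symm _ (hf.pow_const 2).aemeasurable]
        congr 1
        refine lintegral_congr fun w => ?_
        rw [hg, ← ENNReal.rpow_natCast, ← ENNReal.rpow_mul]
        norm_num

theorem IsHypercontractive.pi {μ : Measure ℝ} [IsProbabilityMeasure μ] {ρ σ : ℝ} {k : ℕ}
    (hμ : IsHypercontractive μ ρ σ k) (d : ℕ) :
    IsHypercontractive (Measure.pi fun _ : Fin d => μ) ρ σ k := by
  induction d with
  | zero =>
    intro f hf
    have h0 : ∀ x, f x = f 0 := fun x => congrArg f (Subsingleton.elim _ _)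
    simp [h0, pow_mul]
  | succ d ih =>
    intro f hf
    have mp := (measurePreserving_piFinSuccAbove (fun _ : Fin (d + 1) => μ) 0).symm
    set e := (MeasurableEquiv.piFinSuccAbove (fun _ : Fin (d + 1) => ℝ) 0).symm with he
    have hadd : ∀ x y, e (ρ • x + σ • y) = ρ • e x + σ • e y := by
      intro x y
      ext i
      refine Fin.cases ?_ (fun i => ?_) i <;> simp [he, MeasurableEquiv.piFinSuccAbove]
    have := hμ.prod ih (f ∘ e) (hf.comp e.measurable)
    simp only [Function.comp_apply, hadd] at this
    rw [mp.lintegral_comp_emb e.measurableEmbedding (fun x => f x ^ 2)] at this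
    rw [← mp.lintegral_comp_emb e.measurableEmbedding]
    simp_rw [← mp.lintegral_comp_emb e.measurableEmbedding (fun y => f (_ + σ • y))]
    exact this

/-- The Mehler kernel of parameter `ρ`. -/
noncomputable def mehlerKernel (ρ x z : ℝ) : ℝ :=
  (√(1 - ρ ^ 2))⁻¹ *
    Real.exp (-(ρ ^ 2 * x ^ 2 + ρ ^ 2 * z ^ 2 - 2 * ρ * x * z) / (2 * (1 - ρ ^ 2)))

theorem mehlerKernel_nonneg (ρ x z : ℝ) : 0 ≤ mehlerKernel ρ x z := by
  unfold mehlerKernel; positivity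

theorem measurable_mehlerKernel (ρ x : ℝ) : Measurable (mehlerKernel ρ x) := by
  unfold mehlerKernel; fun_prop

theorem measurable_uncurry_mehlerKernel (ρ : ℝ) :
    Measurable (Function.uncurry (mehlerKernel ρ)) := by
  unfold mehlerKernel Function.uncurry; fun_prop

theorem mehlerKernel_mul_gaussianPDFReal {ρ : ℝ} (hρ : ρ ^ 2 < 1) (x z : ℝ) :
    mehlerKernel ρ x z * gaussianPDFReal 0 1 z =
      gaussianPDFReal (ρ * x) (1 - ρ ^ 2).toNNReal z := by
  have h : 0 < 1 - ρ ^ 2 := by linarith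
  simp only [mehlerKernel, gaussianPDFReal, Real.coe_toNNReal _ h.le, NNReal.coe_one]
  rw [mul_mul_mul_comm, ← Real.exp_add, ← mul_inv, ← Real.sqrt_mul h.le]
  congr 3
  · ring
  · field_simp
    ring

theorem mehlerKernel_sq_mul_gaussianPDFReal {ρ : ℝ} (hρ : ρ ^ 2 < 1) (x z : ℝ) :
    mehlerKernel ρ x z ^ 2 * gaussianPDFReal 0 1 z =
      (√(1 - ρ ^ 4))⁻¹ * Real.exp (ρ ^ 2 * x ^ 2 / (1 + ρ ^ 2)) *
        gaussianPDFReal (2 * ρ * x / (1 + ρ ^ 2)) ((1 - ρ ^ 2) / (1 + ρ ^ 2)).toNNReal z := by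
  have h : 0 < 1 - ρ ^ 2 := by linarith
  have h1 : 0 < 1 + ρ ^ 2 := by positivity
  have h4 : 1 - ρ ^ 4 = (1 - ρ ^ 2) * (1 + ρ ^ 2) := by ring
  have h4' : 0 < 1 - ρ ^ 4 := by rw [h4]; positivity
  simp only [mehlerKernel, gaussianPDFReal, Real.coe_toNNReal _ (div_pos h h1).le, NNReal.coe_one]
  rw [mul_pow, ← Real.exp_nat_mul, mul_mul_mul_comm, ← Real.exp_add, mul_mul_mul_comm,
    ← Real.exp_add, ← mul_inv, ← Real.sqrt_mul h4'.le, inv_pow, ← mul_inv]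
  congr 2
  · have : (1 - ρ ^ 4) * (2 * Real.pi * ((1 - ρ ^ 2) / (1 + ρ ^ 2)))
        = (1 - ρ ^ 2) ^ 2 * (2 * Real.pi * 1) := by
      rw [h4]; field_simp
    rw [this, Real.sqrt_mul (sq_nonneg _), Real.sqrt_sq h.le, Real.sq_sqrt h.le]
  · push_cast
    field_simp
    ring

theorem integral_gaussianReal_eq_integral_mul (g : ℝ → ℝ) :
    ∫ z, g z ∂gaussianReal 0 1 = ∫ z, g z * gaussianPDFReal 0 1 z := by
  rw [integral_gaussianReal_eq_integral_smul one_ne_zero]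
  simp [mul_comm]

theorem integrable_gaussianReal_iff (g : ℝ → ℝ) :
    Integrable g (gaussianReal 0 1) ↔ Integrable fun z => g z * gaussianPDFReal 0 1 z := by
  rw [gaussianReal_of_var_ne_zero _ one_ne_zero,
    integrable_withDensity_iff_integrable_smul' (measurable_gaussianPDF 0 1)
      (ae_of_all _ fun _ => gaussianPDF_lt_top)]
  simp [toReal_gaussianPDF, mul_comm]

theorem integral_mehlerKernel {ρ : ℝ} (hρ : ρ ^ 2 < 1) (x : ℝ) :
    ∫ z, mehlerKernel ρ x z ∂gaussianReal 0 1 = 1 := by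
  rw [integral_gaussianReal_eq_integral_mul]
  simp_rw [mehlerKernel_mul_gaussianPDFReal hρ]
  exact integral_gaussianPDFReal_eq_one _ (by simpa using hρ)

theorem integral_mehlerKernel_sq {ρ : ℝ} (hρ : ρ ^ 2 < 1) (x : ℝ) :
    ∫ z, mehlerKernel ρ x z ^ 2 ∂gaussianReal 0 1 =
      (√(1 - ρ ^ 4))⁻¹ * Real.exp (ρ ^ 2 * x ^ 2 / (1 + ρ ^ 2)) := by
  rw [integral_gaussianReal_eq_integral_mul]
  simp_rw [mehlerKernel_sq_mul_gaussianPDFReal hρ]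
  rw [integral_const_mul, integral_gaussianPDFReal_eq_one, mul_one]
  have h : 0 < 1 - ρ ^ 2 := by linarith
  rw [ne_eq, Real.toNNReal_eq_zero, not_le]
  positivity

theorem memLp_mehlerKernel {ρ : ℝ} (hρ : ρ ^ 2 < 1) (x : ℝ) :
    MemLp (mehlerKernel ρ x) 2 (gaussianReal 0 1) := by
  rw [memLp_two_iff_integrable_sq (measurable_mehlerKernel ρ x).aestronglyMeasurable,
    integrable_gaussianReal_iff]
  simp_rw [mehlerKernel_sq_mul_gaussianPDFReal hρ]
  exact (integrable_gaussianPDFReal _ _).const_mul _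

theorem gaussianReal_map_mehler {ρ : ℝ} (hρ : ρ ^ 2 < 1) (x : ℝ) :
    (gaussianReal 0 1).map (fun y => ρ * x + √(1 - ρ ^ 2) * y) =
      gaussianReal (ρ * x) (1 - ρ ^ 2).toNNReal := by
  have h : 0 < 1 - ρ ^ 2 := by linarith
  have := gaussianReal_map_const_mul (μ := 0) (v := 1) (√(1 - ρ ^ 2))
  have h2 := gaussianReal_map_const_add (μ := √(1 - ρ ^ 2) * 0) (v := (1 - ρ ^ 2).toNNReal) (ρ * x)
  rw [show (fun y => ρ * x + √(1 - ρ ^ 2) * y) = (ρ * x + ·) ∘ (√(1 - ρ ^ 2) * ·) from rfl,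
    ← Measure.map_map (by fun_prop) (by fun_prop), this]
  convert h2 using 3
  · ext
    simp [h.le]
  · simp

theorem lintegral_mehler {ρ : ℝ} (hρ : ρ ^ 2 < 1) {f : ℝ → ℝ≥0∞} (hf : Measurable f) (x : ℝ) :
    ∫⁻ y, f (ρ * x + √(1 - ρ ^ 2) * y) ∂gaussianReal 0 1 =
      ∫⁻ z, ENNReal.ofReal (mehlerKernel ρ x z) * f z ∂gaussianReal 0 1 := by
  have h : (1 - ρ ^ 2).toNNReal ≠ 0 := by simpa using hρ
  have hK := measurable_mehlerKernel ρ x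
  rw [← lintegral_map (f := f) hf (by fun_prop), gaussianReal_map_mehler hρ,
    gaussianReal_of_var_ne_zero _ h, gaussianReal_of_var_ne_zero _ one_ne_zero,
    lintegral_withDensity_eq_lintegral_mul _ (measurable_gaussianPDF _ _) hf,
    lintegral_withDensity_eq_lintegral_mul _ (measurable_gaussianPDF _ _) (by fun_prop)]
  refine lintegral_congr fun z => ?_
  simp only [Pi.mul_apply, gaussianPDF]
  rw [← mehlerKernel_mul_gaussianPDFReal hρ, ENNReal.ofReal_mul (mehlerKernel_nonneg _ _ _)]
  ring

theorem inv_sqrt_one_sub_sq_le_exp {r : ℝ} (h0 : 0 ≤ r) (h1 : r ≤ 1 / 2) :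
    (√(1 - r ^ 2))⁻¹ ≤ Real.exp r := by
  have h : 0 < 1 - r ^ 2 := by nlinarith
  rw [inv_le_comm₀ (Real.sqrt_pos.2 h) (Real.exp_pos _), ← Real.exp_neg]
  refine Real.le_sqrt_of_sq_le ?_
  rw [← Real.exp_nat_mul]
  have : Real.exp ((2 : ℕ) * -r) = (Real.exp (2 * r))⁻¹ := by
    rw [← Real.exp_neg]; push_cast; ring_nf
  rw [this, inv_le_comm₀ (Real.exp_pos _) h]
  refine le_trans ?_ (Real.add_one_le_exp _)
  rw [inv_le_iff_one_le_mul₀ h]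
  nlinarith [mul_nonneg h0 h0, mul_nonneg h0 (sub_nonneg.2 h1)]

/-- The squared `L²` distance from `mehlerKernel ρ x` to the constant `1` is small with `ρ`. -/
theorem integral_mehlerKernel_sub_one_sq_le {ρ : ℝ} (hρ : ρ ^ 2 ≤ 1 / 2) (x : ℝ) :
    ∫ z, (mehlerKernel ρ x z - 1) ^ 2 ∂gaussianReal 0 1 ≤
      ρ ^ 2 * ((1 + x ^ 2) * Real.exp (ρ ^ 2 * (1 + x ^ 2))) := by
  have hρ1 : ρ ^ 2 < 1 := by linarith
  have hM := memLp_mehlerKernel hρ1 x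
  have hi := hM.integrable one_le_two
  have e : ∀ z, (mehlerKernel ρ x z - 1) ^ 2 =
      mehlerKernel ρ x z ^ 2 - 2 * mehlerKernel ρ x z + 1 := fun z => by ring
  simp_rw [e]
  rw [integral_add (f := fun z => mehlerKernel ρ x z ^ 2 - 2 * mehlerKernel ρ x z)
    (hM.integrable_sq.sub (hi.const_mul 2)) (integrable_const _),
    integral_sub hM.integrable_sq (hi.const_mul 2), integral_const_mul, integral_mehlerKernel hρ1,
    integral_mehlerKernel_sq hρ1]
  have h1 : (√(1 - ρ ^ 4))⁻¹ ≤ Real.exp (ρ ^ 2) := by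
    have := inv_sqrt_one_sub_sq_le_exp (sq_nonneg ρ) hρ
    rwa [← pow_mul] at this
  have h2 : Real.exp (ρ ^ 2 * x ^ 2 / (1 + ρ ^ 2)) ≤ Real.exp (ρ ^ 2 * x ^ 2) := by
    refine Real.exp_le_exp.2 (div_le_self (by positivity) ?_)
    nlinarith [sq_nonneg ρ]
  have h3 : (√(1 - ρ ^ 4))⁻¹ * Real.exp (ρ ^ 2 * x ^ 2 / (1 + ρ ^ 2)) ≤
      Real.exp (ρ ^ 2 * (1 + x ^ 2)) := by
    rw [mul_add, mul_one, Real.exp_add]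
    gcongr
  set t := ρ ^ 2 * (1 + x ^ 2) with ht
  have h4 : Real.exp t - 1 ≤ t * Real.exp t := by
    have := Real.add_one_le_exp (-t)
    have h5 : Real.exp (-t) * Real.exp t = 1 := by rw [← Real.exp_add]; simp
    nlinarith [Real.exp_pos t]
  rw [← mul_assoc, ← ht]
  simp
  linarith

theorem integrable_exp_gaussianReal :
    Integrable (fun x : ℝ => Real.exp ((1 + x ^ 2) / 4)) (gaussianReal 0 1) := by
  rw [integrable_gaussianReal_iff]
  have := (integrable_exp_neg_mul_sq (b := 1 / 4) (by norm_num)).const_mul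
    ((√(2 * Real.pi))⁻¹ * Real.exp (1 / 4))
  refine this.congr (ae_of_all _ fun x => ?_)
  simp only [gaussianPDFReal, NNReal.coe_one, mul_one]
  rw [mul_assoc, mul_left_comm (Real.exp _), ← Real.exp_add, ← Real.exp_add]
  congr 2
  ring

theorem exists_mehler_param (c : ℝ) (hc : 0 ≤ c) (i : ℕ) :
    ∃ ρ : ℝ, 0 < ρ ∧ ρ ^ 2 < 1 ∧ ∃ B : ℝ → ℝ,
      (∀ x, ∫ z, (mehlerKernel ρ x z - 1) ^ 2 ∂gaussianReal 0 1 ≤ B x) ∧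
      Integrable B (gaussianReal 0 1) ∧ Integrable (fun x => B x ^ (i + 1)) (gaussianReal 0 1) ∧
      c * ∫ x, B x ∂gaussianReal 0 1 ≤ 1 / 2 ∧
      c * ∫ x, B x ^ (i + 1) ∂gaussianReal 0 1 ≤ 1 / 2 := by
  set G := ∫ x : ℝ, Real.exp ((1 + x ^ 2) / 4) ∂gaussianReal 0 1 with hG
  have hG0 : 0 ≤ G := integral_nonneg fun x => (Real.exp_pos _).le
  set A := c * (8 ^ (i + 1) * (i + 1).factorial * G) + c * (8 * G) with hA
  have hA0 : 0 ≤ A := by positivity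
  set t := min (1 / (8 * (i + 1) : ℝ)) (1 / (2 * (A + 1))) with ht
  have ht0 : 0 < t := by positivity
  have ht1 : (i + 1) * t ≤ 1 / 8 := by
    have : t ≤ 1 / (8 * (i + 1) : ℝ) := min_le_left _ _
    rw [le_div_iff₀ (by positivity)] at this
    linarith
  have ht2 : t * A ≤ 1 / 2 := by
    have : t ≤ 1 / (2 * (A + 1)) := min_le_right _ _
    rw [le_div_iff₀ (by positivity)] at this
    linarith
  have ht3 : t ≤ 1 / 8 := by nlinarith [mul_nonneg (Nat.cast_nonneg (α := ℝ) i) ht0.le]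
  have hsq : √t ^ 2 = t := Real.sq_sqrt ht0.le
  have bound : ∀ k : ℕ, 1 ≤ k → k ≤ i + 1 → ∀ x : ℝ,
      (t * ((1 + x ^ 2) * Real.exp (t * (1 + x ^ 2)))) ^ k ≤
        t * (8 ^ k * k.factorial) * Real.exp ((1 + x ^ 2) / 4) := by
    intro k hk hki x
    have hki' : (k : ℝ) ≤ i + 1 := by exact_mod_cast hki
    set y := 1 + x ^ 2 with hy
    have hy0 : 0 ≤ y := by positivity
    have h1 := Real.pow_div_factorial_le_exp (y / 8) (by positivity) k
    rw [div_le_iff₀ (by positivity), div_pow, div_le_iff₀ (by positivity)] at h1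
    have h2 : Real.exp (t * y) ^ k ≤ Real.exp (y / 8) := by
      rw [← Real.exp_nat_mul]
      refine Real.exp_le_exp.2 ?_
      nlinarith [mul_le_mul_of_nonneg_right hki' (mul_nonneg ht0.le hy0)]
    have h3 : t ^ k ≤ t := by
      simpa using pow_le_pow_of_le_one ht0.le (ht3.trans (by norm_num)) hk
    have h4 : Real.exp (y / 4) = Real.exp (y / 8) * Real.exp (y / 8) := by
      rw [← Real.exp_add]; ring_nf
    rw [mul_pow, mul_pow, h4]
    calc t ^ k * (y ^ k * Real.exp (t * y) ^ k)
        ≤ t * ((Real.exp (y / 8) * k.factorial * 8 ^ k) * Real.exp (y / 8)) := by gcongr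
      _ = _ := by ring
  have int : ∀ k : ℕ, 1 ≤ k → k ≤ i + 1 → Integrable
      (fun x : ℝ => (t * ((1 + x ^ 2) * Real.exp (t * (1 + x ^ 2)))) ^ k) (gaussianReal 0 1) := by
    intro k hk hki
    refine (integrable_exp_gaussianReal.const_mul (t * (8 ^ k * k.factorial))).mono'
      (Measurable.aestronglyMeasurable (by fun_prop)) (ae_of_all _ fun x => ?_)
    rw [Real.norm_of_nonneg (by positivity)]
    exact bound k hk hki x
  have le : ∀ k : ℕ, 1 ≤ k → k ≤ i + 1 →
      ∫ x : ℝ, (t * ((1 + x ^ 2) * Real.exp (t * (1 + x ^ 2)))) ^ k ∂gaussianReal 0 1 ≤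
        t * (8 ^ k * k.factorial * G) := by
    intro k hk hki
    refine (integral_mono (int k hk hki)
      (integrable_exp_gaussianReal.const_mul (t * (8 ^ k * k.factorial))) (bound k hk hki)).trans ?_
    rw [integral_const_mul, ← hG, mul_assoc t]
  have int1 := int 1 le_rfl (by omega)
  have le1 := le 1 le_rfl (by omega)
  simp only [pow_one, Nat.factorial_one, Nat.cast_one, mul_one] at int1 le1
  have le2 := le (i + 1) (by omega) le_rfl
  refine ⟨√t, Real.sqrt_pos.2 ht0, by rw [hsq]; linarith,
    fun x => t * ((1 + x ^ 2) * Real.exp (t * (1 + x ^ 2))), fun x => ?_,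
    int1, int (i + 1) (by omega) le_rfl, ?_, ?_⟩
  · have := integral_mehlerKernel_sub_one_sq_le (ρ := √t) (by rw [hsq]; linarith) x
    rwa [hsq] at this
  · refine (mul_le_mul_of_nonneg_left le1 hc).trans (le_trans ?_ ht2)
    rw [hA]
    have : 0 ≤ t * (c * (8 ^ (i + 1) * (i + 1).factorial * G)) := by positivity
    linarith
  · refine (mul_le_mul_of_nonneg_left le2 hc).trans (le_trans ?_ ht2)
    rw [hA]
    have : 0 ≤ t * (c * (8 * G)) := by positivity
    linarith

theorem exists_taylor_bound (i : ℕ) : ∃ c : ℝ, 0 ≤ c ∧ ∀ a u : ℝ,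
    (a + u) ^ (2 * (i + 1)) ≤ a ^ (2 * (i + 1)) + (2 * (i + 1)) * a ^ (2 * i + 1) * u +
      c * (a ^ (2 * i) * u ^ 2 + u ^ (2 * (i + 1))) := by
  have key : ∀ j : ℕ, ∃ c : ℝ, 0 ≤ c ∧ ∀ a u : ℝ,
      |(a + u) ^ (j + 2) - a ^ (j + 2) - (j + 2) * a ^ (j + 1) * u| ≤
        c * (u ^ 2 * (|a| + |u|) ^ j) := by
    intro j
    induction j with
    | zero =>
      refine ⟨1, zero_le_one, fun a u => le_of_eq ?_⟩
      rw [show (a + u) ^ (0 + 2) - a ^ (0 + 2) - ((0 : ℕ) + 2) * a ^ (0 + 1) * u = u ^ 2 by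
        push_cast; ring]
      simp
    | succ j ih =>
      obtain ⟨c, hc, h⟩ := ih
      refine ⟨c + (j + 2), by positivity, fun a u => ?_⟩
      have e : (a + u) ^ (j + 1 + 2) - a ^ (j + 1 + 2) - ((j + 1 : ℕ) + 2) * a ^ (j + 1 + 1) * u
          = ((a + u) ^ (j + 2) - a ^ (j + 2) - (j + 2) * a ^ (j + 1) * u) * (a + u) +
            (j + 2) * a ^ (j + 1) * u ^ 2 := by push_cast; ring
      rw [e]
      refine (abs_add_le _ _).trans ?_
      rw [abs_mul, abs_mul, abs_mul, abs_pow, abs_pow, sq_abs,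
        abs_of_nonneg (by positivity : (0 : ℝ) ≤ j + 2)]
      calc _ ≤ c * (u ^ 2 * (|a| + |u|) ^ j) * (|a| + |u|) +
            (j + 2) * (|a| + |u|) ^ (j + 1) * u ^ 2 := by
              gcongr
              · exact h a u
              · exact abs_add_le _ _
              · exact le_add_of_nonneg_right (abs_nonneg u)
        _ = _ := by ring
  obtain ⟨c, hc, h⟩ := key (2 * i)
  refine ⟨c * 2 ^ (2 * i - 1), by positivity, fun a u => ?_⟩
  have h1 := (le_abs_self _).trans (h a u)
  have h2 := add_pow_le (abs_nonneg a) (abs_nonneg u) (2 * i)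
  have e1 : |a| ^ (2 * i) = a ^ (2 * i) := by rw [pow_mul, sq_abs, ← pow_mul]
  have e2 : |u| ^ (2 * i) = u ^ (2 * i) := by rw [pow_mul, sq_abs, ← pow_mul]
  rw [e1, e2] at h2
  have h3 : c * (u ^ 2 * (|a| + |u|) ^ (2 * i)) ≤
      c * (u ^ 2 * (2 ^ (2 * i - 1) * (a ^ (2 * i) + u ^ (2 * i)))) := by gcongr
  have e3 : c * 2 ^ (2 * i - 1) * (a ^ (2 * i) * u ^ 2 + u ^ (2 * (i + 1))) =
      c * (u ^ 2 * (2 ^ (2 * i - 1) * (a ^ (2 * i) + u ^ (2 * i)))) := by ring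
  rw [e3, show 2 * (i + 1) = 2 * i + 2 by ring]
  push_cast at h1
  linarith

theorem sq_integral_mul_le {α : Type*} [MeasurableSpace α] {μ : Measure α} {φ ψ : α → ℝ}
    (hφ : MemLp φ 2 μ) (hψ : MemLp ψ 2 μ) :
    (∫ x, φ x * ψ x ∂μ) ^ 2 ≤ (∫ x, φ x ^ 2 ∂μ) * ∫ x, ψ x ^ 2 ∂μ := by
  have hm : Integrable (fun x => φ x * ψ x) μ := hφ.integrable_mul hψ
  have h : ∀ t : ℝ, 0 ≤ (∫ x, ψ x ^ 2 ∂μ) * (t * t) + (2 * ∫ x, φ x * ψ x ∂μ) * t +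
      ∫ x, φ x ^ 2 ∂μ := by
    intro t
    have e : ∫ x, (φ x + t * ψ x) ^ 2 ∂μ = (∫ x, ψ x ^ 2 ∂μ) * (t * t) +
        (2 * ∫ x, φ x * ψ x ∂μ) * t + ∫ x, φ x ^ 2 ∂μ := by
      rw [mul_comm _ (t * t), mul_right_comm 2, ← integral_const_mul,
        ← integral_const_mul, ← integral_add (hψ.integrable_sq.const_mul _) (hm.const_mul _),
        ← integral_add
          (f := fun x => t * t * ψ x ^ 2 + 2 * t * (φ x * ψ x))
          ((hψ.integrable_sq.const_mul _).add (hm.const_mul _)) hφ.integrable_sq]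
      refine integral_congr_ae (ae_of_all _ fun x => ?_)
      simp only
      ring
    rw [← e]
    exact integral_nonneg fun x => sq_nonneg _
  have := discrim_le_zero h
  rw [discrim] at this
  linarith

theorem mehlerKernel_comm (ρ x z : ℝ) : mehlerKernel ρ x z = mehlerKernel ρ z x := by
  unfold mehlerKernel
  ring_nf

theorem lintegral_lintegral_mehler {ρ : ℝ} (hρ : ρ ^ 2 < 1) {f : ℝ → ℝ≥0∞} (hf : Measurable f) :
    ∫⁻ x, ∫⁻ y, f (ρ * x + √(1 - ρ ^ 2) * y) ∂gaussianReal 0 1 ∂gaussianReal 0 1 =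
      ∫⁻ z, f z ∂gaussianReal 0 1 := by
  simp_rw [lintegral_mehler hρ hf]
  have hK := measurable_uncurry_mehlerKernel ρ
  rw [lintegral_lintegral_swap]
  · refine lintegral_congr fun z => ?_
    have hKz : Measurable fun x => mehlerKernel ρ x z := by unfold mehlerKernel; fun_prop
    rw [lintegral_mul_const _ hKz.ennreal_ofReal]
    simp_rw [mehlerKernel_comm ρ _ z]
    rw [← ofReal_integral_eq_lintegral_ofReal
      ((memLp_mehlerKernel hρ z).integrable one_le_two)
      (ae_of_all _ fun _ => mehlerKernel_nonneg _ _ _), integral_mehlerKernel hρ]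
    simp
  · exact ((hK.ennreal_ofReal).mul (hf.comp measurable_snd)).aemeasurable

theorem pow_add_half_le {A S : ℝ} (hA : 0 ≤ A) (hS : 0 ≤ S) (i : ℕ) :
    A ^ (i + 1) + (A ^ i * S + S ^ (i + 1)) / 2 ≤ (A + S) ^ (i + 1) := by
  have h1 : A ^ i ≤ (A + S) ^ i := by gcongr; linarith
  have h2 : S ^ i ≤ (A + S) ^ i := by gcongr; linarith
  have h3 := mul_le_mul_of_nonneg_right h1 hA
  have h4 := mul_le_mul_of_nonneg_right h1 hS
  have h5 := mul_le_mul_of_nonneg_right h2 hS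
  rw [pow_succ, pow_succ, pow_succ]
  linarith

/-- Nelson's hypercontractivity for the one-dimensional Mehler semigroup, at a small parameter. -/
theorem exists_isHypercontractive_gaussianReal (i : ℕ) :
    ∃ ρ : ℝ, 0 < ρ ∧ ρ ^ 2 < 1 ∧
      IsHypercontractive (gaussianReal 0 1) ρ (√(1 - ρ ^ 2)) (i + 1) := by
  obtain ⟨c, hc, taylor⟩ := exists_taylor_bound i
  obtain ⟨ρ, hρ0, hρ, B, hB, hBi, hBi', hcB, hcB'⟩ := exists_mehler_param c hc i
  refine ⟨ρ, hρ0, hρ, fun f hf => ?_⟩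
  simp only [smul_eq_mul]
  set γ := gaussianReal 0 1 with hγ
  rcases eq_or_ne (∫⁻ x, f x ^ 2 ∂γ) ⊤ with htop | hfin
  · rw [htop, ENNReal.top_pow (by omega)]
    exact le_top
  have hfae : ∀ᵐ x ∂γ, f x < ⊤ := by
    filter_upwards [ae_lt_top (hf.pow_const 2) hfin] with x hx
    by_contra h
    simp [not_lt_top_iff.1 h] at hx
  set g : ℝ → ℝ := fun x => (f x).toReal with hg
  have hgm : Measurable g := hf.ennreal_toReal
  have hg0 : ∀ x, 0 ≤ g x := fun x => ENNReal.toReal_nonneg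
  have hfg : ∀ᵐ x ∂γ, f x = ENNReal.ofReal (g x) := by
    filter_upwards [hfae] with x hx
    exact (ENNReal.ofReal_toReal hx.ne).symm
  have hfg2 : ∫⁻ x, f x ^ 2 ∂γ = ∫⁻ x, ENNReal.ofReal (g x ^ 2) ∂γ := by
    refine lintegral_congr_ae ?_
    filter_upwards [hfg] with x hx
    rw [hx, ENNReal.ofReal_pow (hg0 x)]
  have hg2i : Integrable (fun x => g x ^ 2) γ := by
    refine ⟨(hgm.pow_const 2).aestronglyMeasurable, ?_⟩
    rw [hasFiniteIntegral_iff_ofReal (ae_of_all _ fun x => sq_nonneg _), ← hfg2]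
    exact hfin.lt_top
  have hg2 : MemLp g 2 γ := (memLp_two_iff_integrable_sq hgm.aestronglyMeasurable).2 hg2i
  have hgi : Integrable g γ := hg2.integrable one_le_two
  have hK2 := fun x => memLp_mehlerKernel hρ x
  set a := ∫ x, g x ∂γ with ha
  have ha0 : 0 ≤ a := integral_nonneg hg0
  set s := ∫ x, (g x - a) ^ 2 ∂γ with hs
  have hs0 : 0 ≤ s := integral_nonneg fun x => sq_nonneg _
  have hga : MemLp (fun x => g x - a) 2 γ := hg2.sub (memLp_const a)
  have has : ∫ x, g x ^ 2 ∂γ = a ^ 2 + s := by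
    have e : ∀ x, (g x - a) ^ 2 = g x ^ 2 - (2 * a * g x - a ^ 2) := fun x => by ring
    have hi : Integrable (fun x => 2 * a * g x - a ^ 2) γ :=
      (hgi.const_mul _).sub (integrable_const _)
    rw [hs]
    simp_rw [e]
    rw [integral_sub hg2i hi, integral_sub (hgi.const_mul _) (integrable_const _),
      integral_const_mul, ← ha]
    simp
    ring
  set τ : ℝ → ℝ := fun x => ∫ z, mehlerKernel ρ x z * g z ∂γ with hτ
  have hτ0 : ∀ x, 0 ≤ τ x := fun x =>
    integral_nonneg fun z => mul_nonneg (mehlerKernel_nonneg _ _ _) (hg0 z)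
  have hKg : ∀ x, Integrable (fun z => mehlerKernel ρ x z * g z) γ := fun x =>
    (hK2 x).integrable_mul hg2
  have hTτ : ∀ x, ∫⁻ y, f (ρ * x + √(1 - ρ ^ 2) * y) ∂γ = ENNReal.ofReal (τ x) := by
    intro x
    rw [hγ, lintegral_mehler hρ hf, hτ, ofReal_integral_eq_lintegral_ofReal (hKg x)
      (ae_of_all _ fun z => mul_nonneg (mehlerKernel_nonneg _ _ _) (hg0 z))]
    refine lintegral_congr_ae ?_
    filter_upwards [hfg] with z hz
    rw [hz, ENNReal.ofReal_mul (mehlerKernel_nonneg _ _ _)]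
  have hτm : Measurable τ := by
    have h : Measurable fun x => ∫⁻ y, f (ρ * x + √(1 - ρ ^ 2) * y) ∂γ :=
      Measurable.lintegral_prod_right'
        (f := fun z : ℝ × ℝ => f (ρ * z.1 + √(1 - ρ ^ 2) * z.2)) (by fun_prop)
    convert h.ennreal_toReal with x
    rw [hTτ, ENNReal.toReal_ofReal (hτ0 x)]
  have hτl : ∫⁻ x, ENNReal.ofReal (τ x) ∂γ = ENNReal.ofReal a := by
    simp_rw [← hTτ]
    rw [hγ, lintegral_lintegral_mehler hρ hf, ha,
      ofReal_integral_eq_lintegral_ofReal hgi (ae_of_all _ hg0)]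
    exact lintegral_congr_ae hfg
  have hτi : Integrable τ γ := by
    refine ⟨hτm.aestronglyMeasurable, ?_⟩
    rw [hasFiniteIntegral_iff_ofReal (ae_of_all _ hτ0), hτl]
    exact ENNReal.ofReal_lt_top
  have hτa : ∫ x, τ x ∂γ = a := by
    rw [integral_eq_lintegral_of_nonneg_ae (ae_of_all _ hτ0) hτm.aestronglyMeasurable, hτl,
      ENNReal.toReal_ofReal ha0]
  have hu : ∀ x, (τ x - a) ^ 2 ≤ s * B x := by
    intro x
    have hKi := (hK2 x).integrable one_le_two
    have e : τ x - a = ∫ z, (g z - a) * (mehlerKernel ρ x z - 1) ∂γ := by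
      have e' : ∀ z, (g z - a) * (mehlerKernel ρ x z - 1) =
          (mehlerKernel ρ x z * g z - g z) - (a * mehlerKernel ρ x z - a) := fun z => by ring
      simp_rw [e']
      rw [integral_sub (f := fun z => mehlerKernel ρ x z * g z - g z)
        (g := fun z => a * mehlerKernel ρ x z - a)
        ((hKg x).sub hgi) ((hKi.const_mul a).sub (integrable_const a)),
        integral_sub (hKg x) hgi, integral_sub (hKi.const_mul a) (integrable_const a),
        integral_const_mul, integral_mehlerKernel hρ]
      simp [hτ, ha]
    rw [e]
    exact (sq_integral_mul_le hga ((hK2 x).sub (memLp_const 1))).trans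
      (mul_le_mul_of_nonneg_left (hB x) hs0)
  have hB0 : ∀ x, 0 ≤ B x := fun x => (integral_nonneg fun z => sq_nonneg _).trans (hB x)
  set R : ℝ → ℝ := fun x => a ^ (2 * (i + 1)) + (2 * (i + 1)) * a ^ (2 * i + 1) * (τ x - a) +
    (c * (a ^ (2 * i) * s) * B x + c * s ^ (i + 1) * B x ^ (i + 1)) with hR
  have hτR : ∀ x, τ x ^ (2 * (i + 1)) ≤ R x := by
    intro x
    have h := taylor a (τ x - a)
    rw [add_sub_cancel] at h
    refine h.trans ?_
    have h2 : (τ x - a) ^ (2 * (i + 1)) ≤ (s * B x) ^ (i + 1) := by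
      rw [pow_mul]; gcongr; exact hu x
    have h1 : a ^ (2 * i) * (τ x - a) ^ 2 ≤ a ^ (2 * i) * (s * B x) := by
      gcongr; exact hu x
    have h3 := mul_le_mul_of_nonneg_left (add_le_add h1 h2) hc
    rw [mul_pow] at h3
    simp only [hR]
    linarith
  have hR1 : Integrable (fun x => (2 * (i + 1)) * a ^ (2 * i + 1) * (τ x - a)) γ :=
    (hτi.sub (integrable_const a)).const_mul _
  have hR2 : Integrable (fun x => a ^ (2 * (i + 1)) +
      (2 * (i + 1)) * a ^ (2 * i + 1) * (τ x - a)) γ := (integrable_const _).add hR1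
  have hR3 : Integrable (fun x => c * (a ^ (2 * i) * s) * B x +
      c * s ^ (i + 1) * B x ^ (i + 1)) γ := (hBi.const_mul _).add (hBi'.const_mul _)
  have hRi : Integrable R γ := hR2.add hR3
  have hRint : ∫ x, R x ∂γ ≤ (a ^ 2 + s) ^ (i + 1) := by
    rw [hR, integral_add hR2 hR3, integral_add (integrable_const _) hR1,
      integral_add (hBi.const_mul _) (hBi'.const_mul _), integral_const_mul, integral_const_mul,
      integral_const_mul, integral_sub hτi (integrable_const a), hτa]
    refine le_trans ?_ (pow_add_half_le (sq_nonneg a) hs0 i)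
    have h1 := mul_le_mul_of_nonneg_left hcB (by positivity : 0 ≤ a ^ (2 * i) * s)
    have h2 := mul_le_mul_of_nonneg_left hcB' (by positivity : 0 ≤ s ^ (i + 1))
    simp only [integral_const, probReal_univ, smul_eq_mul, one_mul, sub_self, mul_zero, add_zero,
      ← pow_mul]
    linarith
  calc ∫⁻ x, (∫⁻ y, f (ρ * x + √(1 - ρ ^ 2) * y) ∂γ) ^ (2 * (i + 1)) ∂γ
      = ∫⁻ x, ENNReal.ofReal (τ x ^ (2 * (i + 1))) ∂γ := by
        refine lintegral_congr fun x => ?_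
        rw [hTτ, ENNReal.ofReal_pow (hτ0 x)]
    _ ≤ ∫⁻ x, ENNReal.ofReal (R x) ∂γ := by
        gcongr with x
        exact hτR x
    _ = ENNReal.ofReal (∫ x, R x ∂γ) := by
        rw [ofReal_integral_eq_lintegral_ofReal hRi
          (ae_of_all _ fun x => (pow_nonneg (hτ0 x) _).trans (hτR x))]
    _ ≤ ENNReal.ofReal ((a ^ 2 + s) ^ (i + 1)) := ENNReal.ofReal_le_ofReal hRint
    _ = (∫⁻ x, f x ^ 2 ∂γ) ^ (i + 1) := by
        rw [ENNReal.ofReal_pow (by positivity), ← has, hfg2,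
          ofReal_integral_eq_lintegral_ofReal hg2i (ae_of_all _ fun x => sq_nonneg _)]

/-- The `n`-th probabilists Hermite polynomial, with real coefficients. -/
noncomputable def realHermite (n : ℕ) : Polynomial ℝ :=
  (Polynomial.hermite n).map (Int.castRingHom ℝ)

theorem realHermite_succ (n : ℕ) :
    realHermite (n + 1) = Polynomial.X * realHermite n - Polynomial.derivative (realHermite n) := by
  simp [realHermite, Polynomial.hermite_succ, Polynomial.derivative_map]

theorem derivative_realHermite_succ (n : ℕ) :
    Polynomial.derivative (realHermite (n + 1)) = Polynomial.C ((n : ℝ) + 1) * realHermite n := by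
  induction n with
  | zero => simp [realHermite]
  | succ n ih =>
    rw [realHermite_succ (n + 1), Polynomial.derivative_sub, Polynomial.derivative_mul, ih,
      Polynomial.derivative_mul, realHermite_succ n]
    simp
    ring

theorem hermiteFun_eq (n : ℕ) (x : ℝ) :
    hermiteFun n x = (n.factorial : ℝ)⁻¹ * (realHermite n).eval x := by
  have h := Polynomial.hermite_eq_deriv_gaussian n x
  rw [Polynomial.aeval_def, Polynomial.eval₂_eq_eval_map] at h
  have e : (fun y : ℝ => Real.exp (-(y ^ 2) / 2)) = fun y => Real.exp (-(y ^ 2 / 2)) := by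
    ext y; rw [neg_div]
  rw [hermiteFun, realHermite, iteratedDeriv_eq_iterate, e]
  erw [h]
  rw [Real.exp_neg]
  field_simp

theorem integrable_eval_gaussianReal (q : Polynomial ℝ) :
    Integrable (fun t => q.eval t) (gaussianReal 0 1) := by
  induction q using Polynomial.induction_on' with
  | add p q hp hq => exact (hp.add hq).congr (ae_of_all _ fun t => by simp)
  | monomial n a =>
    simp only [Polynomial.eval_monomial]
    refine Integrable.const_mul ?_ a
    have := (memLp_id_gaussianReal (μ := 0) (v := 1) (n : ℝ≥0)).integrable_norm_pow'
    simp only [id] at this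
    rw [← integrable_norm_iff (by fun_prop)]
    simpa using this

/-- Gaussian integration by parts for polynomials. -/
theorem integral_mul_eval_gaussianReal (q : Polynomial ℝ) :
    ∫ t, t * q.eval t ∂gaussianReal 0 1 = ∫ t, q.derivative.eval t ∂gaussianReal 0 1 := by
  have hint : ∀ r : Polynomial ℝ, Integrable fun z => r.eval z * gaussianPDFReal 0 1 z := by
    intro r
    have := integrable_eval_gaussianReal r
    rw [gaussianReal_of_var_ne_zero _ one_ne_zero,
      integrable_withDensity_iff_integrable_smul' (measurable_gaussianPDF 0 1)
      (ae_of_all _ fun _ => gaussianPDF_lt_top)] at this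
    simpa [toReal_gaussianPDF, mul_comm] using this
  have hder : ∀ t : ℝ, HasDerivAt (gaussianPDFReal 0 1) (-t * gaussianPDFReal 0 1 t) t := by
    intro t
    have h : HasDerivAt (fun t : ℝ => -(t - 0) ^ 2 / (2 * ((1 : ℝ≥0) : ℝ))) (-t) t := by
      have := (((hasDerivAt_id t).sub_const 0).pow 2).neg.div_const (2 * ((1 : ℝ≥0) : ℝ))
      exact this.congr_deriv (by simp; ring)
    have := h.exp.const_mul (√(2 * Real.pi * ((1 : ℝ≥0) : ℝ)))⁻¹
    refine this.congr_deriv ?_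
    simp only [gaussianPDFReal]
    ring
  have ibp := integral_mul_deriv_eq_deriv_mul_of_integrable
    (u := fun t => q.eval t) (v := gaussianPDFReal 0 1) (u' := fun t => q.derivative.eval t)
    (v' := fun t => -t * gaussianPDFReal 0 1 t)
    (fun t _ => q.hasDerivAt t) (fun t _ => hder t)
    (by
      have := (hint (-Polynomial.X * q))
      refine this.congr (ae_of_all _ fun z => ?_)
      simp
      ring)
    (hint _) (hint _)
  rw [integral_gaussianReal_eq_integral_smul one_ne_zero,
    integral_gaussianReal_eq_integral_smul one_ne_zero]
  simp only [smul_eq_mul]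
  simp_rw [mul_comm (gaussianPDFReal 0 1 _)]
  rw [← neg_eq_iff_eq_neg.2 ibp, ← integral_neg]
  refine integral_congr_ae (ae_of_all _ fun t => ?_)
  simp only
  ring

theorem integrable_eval_affine_gaussianReal (q : Polynomial ℝ) (a b : ℝ) :
    Integrable (fun t => q.eval (a + b * t)) (gaussianReal 0 1) := by
  exact (integrable_eval_gaussianReal
    (q.comp (Polynomial.C a + Polynomial.C b * Polynomial.X))).congr
    (ae_of_all _ fun t => by simp [Polynomial.eval_comp])

/-- The Hermite polynomials are eigenfunctions of the Mehler averaging operator. -/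
theorem integral_realHermite_mehler {ρ σ : ℝ} (h : ρ ^ 2 + σ ^ 2 = 1) (n : ℕ) (x : ℝ) :
    ∫ t, (realHermite n).eval (ρ * x + σ * t) ∂gaussianReal 0 1 =
      ρ ^ n * (realHermite n).eval x := by
  have step : ∀ m, ∫ t, (realHermite (m + 1)).eval (ρ * x + σ * t) ∂gaussianReal 0 1 =
      ρ * x * ∫ t, (realHermite m).eval (ρ * x + σ * t) ∂gaussianReal 0 1 -
      ρ ^ 2 * ∫ t, (realHermite m).derivative.eval (ρ * x + σ * t) ∂gaussianReal 0 1 := by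
    intro m
    have stein := integral_mul_eval_gaussianReal
      ((realHermite m).comp (Polynomial.C (ρ * x) + Polynomial.C σ * Polynomial.X))
    rw [Polynomial.derivative_comp] at stein
    simp only [Polynomial.eval_comp, Polynomial.eval_add, Polynomial.eval_mul, Polynomial.eval_C,
      Polynomial.eval_X, Polynomial.derivative_add, Polynomial.derivative_C, zero_add,
      Polynomial.derivative_mul, zero_mul, Polynomial.derivative_X, mul_one] at stein
    rw [integral_const_mul] at stein
    have i0 := integrable_eval_affine_gaussianReal (realHermite m) (ρ * x) σ
    have i1 := integrable_eval_affine_gaussianReal (realHermite m).derivative (ρ * x) σ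
    have i2 : Integrable (fun t => t * (realHermite m).eval (ρ * x + σ * t))
        (gaussianReal 0 1) := by
      exact (integrable_eval_gaussianReal (Polynomial.X *
        (realHermite m).comp (Polynomial.C (ρ * x) + Polynomial.C σ * Polynomial.X))).congr
        (ae_of_all _ fun t => by simp [Polynomial.eval_comp])
    have e : ∀ t, (realHermite (m + 1)).eval (ρ * x + σ * t) =
        (ρ * x * (realHermite m).eval (ρ * x + σ * t) +
          σ * (t * (realHermite m).eval (ρ * x + σ * t))) -
          (realHermite m).derivative.eval (ρ * x + σ * t) := by
      intro t
      rw [realHermite_succ]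
      simp
      ring
    simp_rw [e]
    rw [integral_sub (f := fun t => ρ * x * (realHermite m).eval (ρ * x + σ * t) +
          σ * (t * (realHermite m).eval (ρ * x + σ * t)))
        ((i0.const_mul _).add (i2.const_mul _)) i1, integral_add (i0.const_mul _) (i2.const_mul _),
      integral_const_mul, integral_const_mul, stein]
    linear_combination (∫ t, (realHermite m).derivative.eval (ρ * x + σ * t) ∂gaussianReal 0 1) * h
  induction n using Nat.strong_induction_on with
  | _ n ih =>
    match n with
    | 0 => simp [realHermite]
    | 1 =>
      rw [step 0]
      simp [realHermite]
    | m + 2 =>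
      rw [step, ih (m + 1) (by omega), realHermite_succ (m + 1), derivative_realHermite_succ]
      simp only [Polynomial.eval_mul, Polynomial.eval_C, integral_const_mul, ih m (by omega),
        Polynomial.eval_sub, Polynomial.eval_X]
      ring

theorem IsHypercontractive.eLpNorm_le {E X : Type*} [MeasurableSpace E] [AddCommGroup E]
    [Module ℝ E] [NormedAddCommGroup X] [NormedSpace ℝ X] {μ : Measure E} {ρ σ : ℝ} {k : ℕ}
    (h : IsHypercontractive μ ρ σ k) (hρ : 0 < ρ) (hk : k ≠ 0) (n : ℕ) {G : E → X}
    (hGm : Measurable fun x => ‖G x‖ₑ)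
    (hG : ∀ x, ∫ y, G (ρ • x + σ • y) ∂μ = ρ ^ n • G x) :
    eLpNorm G (2 * k : ℕ) μ ≤ ENNReal.ofReal ((ρ ^ n)⁻¹) * eLpNorm G 2 μ := by
  set c := ENNReal.ofReal ((ρ ^ n)⁻¹) with hc
  have hpt : ∀ x, ‖G x‖ₑ ≤ c * ∫⁻ y, ‖G (ρ • x + σ • y)‖ₑ ∂μ := by
    intro x
    have e : G x = (ρ ^ n)⁻¹ • ∫ y, G (ρ • x + σ • y) ∂μ := by
      rw [hG, inv_smul_smul₀ (by positivity)]
    conv_lhs => rw [e, enorm_smul, Real.enorm_eq_ofReal (by positivity)]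
    gcongr
    exact enorm_integral_le_lintegral_enorm _
  have hkey : ∫⁻ x, ‖G x‖ₑ ^ (2 * k) ∂μ ≤ c ^ (2 * k) * (∫⁻ x, ‖G x‖ₑ ^ 2 ∂μ) ^ k := by
    calc ∫⁻ x, ‖G x‖ₑ ^ (2 * k) ∂μ
        ≤ ∫⁻ x, c ^ (2 * k) * (∫⁻ y, ‖G (ρ • x + σ • y)‖ₑ ∂μ) ^ (2 * k) ∂μ := by
          gcongr with x
          rw [← mul_pow]
          gcongr
          exact hpt x
      _ = c ^ (2 * k) * ∫⁻ x, (∫⁻ y, ‖G (ρ • x + σ • y)‖ₑ ∂μ) ^ (2 * k) ∂μ :=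
          lintegral_const_mul' _ _ (by finiteness)
      _ ≤ _ := by
          gcongr
          exact h _ hGm
  have hk' : (k : ℝ) ≠ 0 := by exact_mod_cast hk
  rw [eLpNorm_eq_lintegral_rpow_enorm_toReal (by simpa using hk)
      (ENNReal.natCast_ne_top _),
    eLpNorm_eq_lintegral_rpow_enorm_toReal (by simp) (by simp)]
  simp only [ENNReal.toReal_natCast, ENNReal.rpow_natCast, ENNReal.toReal_ofNat,
    ENNReal.rpow_ofNat]
  refine (ENNReal.rpow_le_rpow hkey (by positivity)).trans (le_of_eq ?_)
  rw [ENNReal.mul_rpow_of_nonneg _ _ (by positivity), ← ENNReal.rpow_natCast,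
    ← ENNReal.rpow_natCast, ← ENNReal.rpow_mul, ← ENNReal.rpow_mul]
  push_cast
  congr 2
  · field_simp
    simp
  · field_simp

section isonormal

variable {H : Type*} [NormedAddCommGroup H] [InnerProductSpace ℝ H]
    {Ω : Type*} [MeasurableSpace Ω] {P : Measure Ω} {W : H → Ω → ℝ}

theorem IsIsonormal.memLp (hW : IsIsonormal P W) (h : H) : MemLp (W h) 2 P := by
  have := memLp_id_gaussianReal (μ := 0) (v := ‖h‖₊ ^ 2) 2
  rw [← hW.gaussian h] at this
  simpa using this.comp_of_map (hW.meas h).aemeasurable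

theorem IsIsonormal.integrable_mul (hW : IsIsonormal P W) (a b : H) :
    Integrable (fun ω => W a ω * W b ω) P := (hW.memLp a).integrable_mul (hW.memLp b)

/-- An isonormal process is almost surely linear along each two-term combination. -/
theorem IsIsonormal.smul_add_ae (hW : IsIsonormal P W) (c : ℝ) (a b : H) :
    W (c • a + b) =ᵐ[P] fun ω => c * W a ω + W b ω := by
  set d := c • a + b with hd
  have hi := hW.integrable_mul
  have hz : ∫ ω, (W d ω - (c * W a ω + W b ω)) ^ 2 ∂P = 0 := by
    have e : ∀ ω, (W d ω - (c * W a ω + W b ω)) ^ 2 =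
        W d ω * W d ω + (-2 * c) * (W d ω * W a ω) + (-2) * (W d ω * W b ω) +
        c ^ 2 * (W a ω * W a ω) + (2 * c) * (W a ω * W b ω) + W b ω * W b ω := fun ω => by ring
    simp_rw [e]
    have i1 := (hi d d).add ((hi d a).const_mul (-2 * c))
    have i2 := i1.add ((hi d b).const_mul (-2))
    have i3 := i2.add ((hi a a).const_mul (c ^ 2))
    have i4 := i3.add ((hi a b).const_mul (2 * c))
    refine (integral_add i4 (hi b b)).trans ?_
    erw [integral_add i3 ((hi a b).const_mul (2 * c)), integral_add i2 ((hi a a).const_mul (c ^ 2)),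
      integral_add i1 ((hi d b).const_mul (-2)),
      integral_add (hi d d) ((hi d a).const_mul (-2 * c))]
    simp only [integral_const_mul, hW.cov]
    simp only [hd, inner_add_left, inner_add_right, inner_smul_left, inner_smul_right,
      real_inner_comm a b, RCLike.conj_to_real]
    ring
  rw [integral_eq_zero_iff_of_nonneg (fun ω => sq_nonneg _)] at hz
  · filter_upwards [hz] with ω hω
    simpa [sub_eq_zero] using hω
  · exact ((hW.memLp d).sub (((hW.memLp a).const_mul c).add (hW.memLp b))).integrable_sq

theorem IsIsonormal.zero_ae (hW : IsIsonormal P W) : W 0 =ᵐ[P] 0 := by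
  have := hW.smul_add_ae (-1) 0 0
  filter_upwards [this] with ω hω
  simp at hω
  simpa using hω

theorem IsIsonormal.sum_ae (hW : IsIsonormal P W) {ι : Type*} (s : Finset ι) (c : ι → ℝ)
    (e : ι → H) : W (∑ i ∈ s, c i • e i) =ᵐ[P] fun ω => ∑ i ∈ s, c i * W (e i) ω := by
  classical
  induction s using Finset.induction_on with
  | empty =>
    simp only [Finset.sum_empty]
    exact hW.zero_ae
  | insert i s hi ih =>
    rw [Finset.sum_insert hi]
    filter_upwards [ih, hW.smul_add_ae (c i) (e i) (∑ i ∈ s, c i • e i)] with ω h1 h2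
    rw [h2, h1, Finset.sum_insert hi]

/-- The value of an isonormal process at a unit vector is a standard normal variable. -/
theorem IsIsonormal.map_unit (hW : IsIsonormal P W) {h : H} (hh : ‖h‖ = 1) :
    P.map (W h) = gaussianReal 0 1 := by
  have h1 : ‖h‖₊ = 1 := NNReal.coe_inj.1 (by simpa using hh)
  rw [hW.gaussian, h1, one_pow]

/-- An orthonormal family is mapped to independent standard normal variables. -/
theorem IsIsonormal.map_orthonormal [IsProbabilityMeasure P] (hW : IsIsonormal P W) {d : ℕ}
    {e : Fin d → H} (he : Orthonormal ℝ e) :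
    P.map (fun ω i => W (e i) ω) = Measure.pi fun _ : Fin d => gaussianReal 0 1 := by
  have hm : ∀ i, AEMeasurable (W (e i)) P := fun i => (hW.meas _).aemeasurable
  have hlaw : ∀ i, P.map (W (e i)) = gaussianReal 0 1 := fun i => hW.map_unit (he.1 i)
  have hind : iIndepFun (fun i => W (e i)) P := by
    rw [iIndepFun_iff_charFun_pi hm]
    intro t
    have h1 := hW.sum_ae Finset.univ (fun i => t i) e
    have h2 : charFun (P.map fun ω => WithLp.toLp 2 fun i => W (e i) ω) t =
        charFun (P.map (W (∑ i, t i • e i))) 1 := by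
      rw [charFun_apply, charFun_apply, integral_map, integral_map]
      · refine integral_congr_ae ?_
        filter_upwards [h1] with ω hω
        simp [hω, PiLp.inner_apply, mul_comm]
      · exact (hW.meas _).aemeasurable
      · exact Measurable.aestronglyMeasurable (by fun_prop)
      · exact Measurable.aemeasurable (by have := hW.meas; fun_prop)
      · exact Measurable.aestronglyMeasurable (by fun_prop)
    rw [h2, hW.gaussian]
    simp_rw [hlaw, charFun_gaussianReal]
    rw [← Complex.exp_sum]
    congr 1
    have h3 : ‖∑ i, t i • e i‖ ^ 2 = ∑ i, t i ^ 2 := by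
      rw [← real_inner_self_eq_norm_sq, he.inner_sum]
      simp [sq]
    have h4 : (‖∑ i, t i • e i‖ : ℂ) ^ 2 = ∑ i, (t i : ℂ) ^ 2 := by exact_mod_cast h3
    simp [h4, Finset.sum_div]
  rw [iIndepFun_iff_map_fun_eq_pi_map hm] at hind
  rw [hind]
  simp_rw [hlaw]

end isonormal

/-- Finitely many vectors are combinations of a finite orthonormal family. -/
theorem exists_orthonormal_expansion {H : Type*} [NormedAddCommGroup H] [InnerProductSpace ℝ H]
    {ι : Type*} [Finite ι] (u : ι → H) :
    ∃ (d : ℕ) (e : Fin d → H) (a : ι → Fin d → ℝ), Orthonormal ℝ e ∧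
      ∀ i, u i = ∑ k, a i k • e k := by
  let U := Submodule.span ℝ (Set.range u)
  have : FiniteDimensional ℝ U := FiniteDimensional.span_of_finite ℝ (Set.finite_range u)
  let b := stdOrthonormalBasis ℝ U
  let u' : ι → U := fun i => ⟨u i, Submodule.subset_span ⟨i, rfl⟩⟩
  refine ⟨_, fun k => (b k : H), fun i k => b.repr (u' i) k,
    b.orthonormal.comp_linearIsometry U.subtypeₗᵢ, fun i => ?_⟩
  have := congrArg (Subtype.val) (b.sum_repr (u' i))
  simpa [u'] using this.symm

theorem continuous_hermiteFun (n : ℕ) : Continuous (hermiteFun n) := by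
  have : hermiteFun n = fun x => (n.factorial : ℝ)⁻¹ * (realHermite n).eval x :=
    funext (hermiteFun_eq n)
  rw [this]
  fun_prop

theorem integral_hermiteFun_mehler {ρ σ : ℝ} (h : ρ ^ 2 + σ ^ 2 = 1) (n : ℕ) (x : ℝ) :
    ∫ t, hermiteFun n (ρ * x + σ * t) ∂gaussianReal 0 1 = ρ ^ n * hermiteFun n x := by
  simp_rw [hermiteFun_eq, integral_const_mul, integral_realHermite_mehler h]
  ring

theorem integrable_hermiteFun_affine (n : ℕ) (a b : ℝ) :
    Integrable (fun t => hermiteFun n (a + b * t)) (gaussianReal 0 1) := by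
  simp_rw [hermiteFun_eq]
  exact (integrable_eval_affine_gaussianReal _ a b).const_mul _

theorem IsIsonormal.eLpNorm_sum_hermiteFun_le {H : Type*} [NormedAddCommGroup H]
    [InnerProductSpace ℝ H] {Ω : Type*} [MeasurableSpace Ω] {P : Measure Ω}
    [IsProbabilityMeasure P] {W : H → Ω → ℝ} (hW : IsIsonormal P W)
    {X : Type*} [NormedAddCommGroup X] [NormedSpace ℝ X] [CompleteSpace X]
    {ρ : ℝ} (hρ : 0 < ρ) (hρ' : ρ ^ 2 < 1) {k : ℕ} (hk : k ≠ 0)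
    (hγ : IsHypercontractive (gaussianReal 0 1) ρ (√(1 - ρ ^ 2)) k) (n : ℕ)
    {ι : Type*} [Fintype ι] (u : ι → H) (hu : ∀ i, ‖u i‖ = 1) (v : ι → X) :
    eLpNorm (fun ω => ∑ i, hermiteFun n (W (u i) ω) • v i) (2 * k : ℕ) P ≤
      ENNReal.ofReal ((ρ ^ n)⁻¹) *
        eLpNorm (fun ω => ∑ i, hermiteFun n (W (u i) ω) • v i) 2 P := by
  obtain ⟨d, e, a, he, hue⟩ := exists_orthonormal_expansion u
  set σ := √(1 - ρ ^ 2) with hσ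
  have hρσ : ρ ^ 2 + σ ^ 2 = 1 := by
    rw [hσ, Real.sq_sqrt (by linarith)]
    ring
  have hWm := hW.meas
  have hc := continuous_hermiteFun n
  let L : ι → (Fin d → ℝ) → ℝ := fun i y => ∑ k, a i k * y k
  let G : (Fin d → ℝ) → X := fun y => ∑ i, hermiteFun n (L i y) • v i
  have hGc : Continuous G := by fun_prop
  have hae : ∀ i, W (u i) =ᵐ[P] fun ω => L i fun k => W (e k) ω := fun i => by
    rw [hue i]
    exact hW.sum_ae Finset.univ (a i) e
  have hlaw : ∀ i, (Measure.pi fun _ : Fin d => gaussianReal 0 1).map (L i) =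
      gaussianReal 0 1 := fun i => by
    rw [← hW.map_orthonormal he, Measure.map_map (by fun_prop) (by fun_prop),
      ← hW.map_unit (hu i)]
    exact Measure.map_congr (hae i).symm
  have hLadd : ∀ i x y, L i (ρ • x + σ • y) = ρ * L i x + σ * L i y := fun i x y => by
    simp only [L, Finset.mul_sum, ← Finset.sum_add_distrib, Pi.add_apply, Pi.smul_apply,
      smul_eq_mul]
    exact Finset.sum_congr rfl fun k _ => by ring
  have hG : ∀ x, ∫ y, G (ρ • x + σ • y) ∂(Measure.pi fun _ : Fin d => gaussianReal 0 1) =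
      ρ ^ n • G x := fun x => by
    have hint : ∀ i, Integrable (fun y => hermiteFun n (ρ * L i x + σ * L i y))
        (Measure.pi fun _ : Fin d => gaussianReal 0 1) := fun i => by
      have := integrable_hermiteFun_affine n (ρ * L i x) σ
      rw [← hlaw i] at this
      exact this.comp_measurable (by fun_prop)
    simp only [G, hLadd]
    rw [integral_finsetSum _ fun i _ => (hint i).smul_const _, Finset.smul_sum]
    refine Finset.sum_congr rfl fun i _ => ?_
    have hi := integral_hermiteFun_mehler hρσ n (L i x)
    rw [← hlaw i,
      integral_map (by fun_prop) (Measurable.aestronglyMeasurable (by fun_prop))] at hi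
    rw [integral_smul_const, smul_smul, hi]
  have key := (hγ.pi d).eLpNorm_le hρ hk n hGc.enorm.measurable hG
  rw [← hW.map_orthonormal he, eLpNorm_map_measure hGc.aestronglyMeasurable (by fun_prop),
    eLpNorm_map_measure hGc.aestronglyMeasurable (by fun_prop)] at key
  have hF : (fun ω => ∑ i, hermiteFun n (W (u i) ω) • v i) =ᵐ[P]
      G ∘ fun ω k => W (e k) ω := by
    filter_upwards [ae_all_iff.2 hae] with ω hω
    simp only [G, Function.comp_apply, hω]
  rwa [eLpNorm_congr_ae hF, eLpNorm_congr_ae hF]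

/-- The functions `ω ↦ H_n(W(h)(ω)) x` with `‖h‖ = 1`, spanning the elementary `X`-valued chaos. -/
def elementaryChaos {H : Type*} [NormedAddCommGroup H] {Ω : Type*} (W : H → Ω → ℝ) (n : ℕ)
    (X : Type*) [NormedAddCommGroup X] [NormedSpace ℝ X] : Submodule ℝ (Ω → X) :=
  Submodule.span ℝ {F | ∃ h : H, ‖h‖ = 1 ∧ ∃ x : X, F = fun ω => hermiteFun n (W h ω) • x}

theorem IsIsonormal.eLpNorm_le_of_mem_elementaryChaos {H : Type*} [NormedAddCommGroup H]
    [InnerProductSpace ℝ H] {Ω : Type*} [MeasurableSpace Ω] {P : Measure Ω}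
    [IsProbabilityMeasure P] {W : H → Ω → ℝ} (hW : IsIsonormal P W)
    {X : Type*} [NormedAddCommGroup X] [NormedSpace ℝ X] [CompleteSpace X]
    {ρ : ℝ} (hρ : 0 < ρ) (hρ' : ρ ^ 2 < 1) {k : ℕ} (hk : k ≠ 0)
    (hγ : IsHypercontractive (gaussianReal 0 1) ρ (√(1 - ρ ^ 2)) k) (n : ℕ)
    {F : Ω → X} (hF : F ∈ elementaryChaos W n X) :
    eLpNorm F (2 * k : ℕ) P ≤ ENNReal.ofReal ((ρ ^ n)⁻¹) * eLpNorm F 2 P := by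
  obtain ⟨m, c, g, rfl⟩ := Submodule.mem_span_set'.1 hF
  choose u hu x hx using fun i => (g i).2
  have : ∑ i, c i • (g i : Ω → X) = fun ω => ∑ i, hermiteFun n (W (u i) ω) • c i • x i := by
    ext ω
    simp [hx, smul_comm (c _)]
  rw [this]
  exact hW.eLpNorm_sum_hermiteFun_le hρ hρ' hk hγ n u hu fun i => c i • x i

theorem exists_mem_elementaryChaos {H : Type*} [NormedAddCommGroup H] [InnerProductSpace ℝ H]
    {Ω : Type*} [MeasurableSpace Ω] {P : Measure Ω} {W : H → Ω → ℝ} {n : ℕ}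
    {X : Type*} [NormedAddCommGroup X] [NormedSpace ℝ X] {f : Lp ℝ 2 P}
    (hf : f ∈ Submodule.span ℝ
      {f : Lp ℝ 2 P | ∃ h : H, ‖h‖ = 1 ∧ ∀ᵐ ω ∂P, f ω = hermiteFun n (W h ω)}) (x : X) :
    ∃ F ∈ elementaryChaos W n X, (fun ω => f ω • x) =ᵐ[P] F := by
  induction hf using Submodule.span_induction with
  | mem f hf =>
    obtain ⟨h, hh, hfh⟩ := hf
    refine ⟨_, Submodule.subset_span ⟨h, hh, x, rfl⟩, ?_⟩
    filter_upwards [hfh] with ω hω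
    rw [hω]
  | zero =>
    refine ⟨0, zero_mem _, ?_⟩
    filter_upwards [Lp.coeFn_zero ℝ 2 P] with ω hω
    rw [hω]
    simp
  | add f g _ _ hf hg =>
    obtain ⟨F, hF, hfF⟩ := hf
    obtain ⟨G, hG, hgG⟩ := hg
    refine ⟨F + G, add_mem hF hG, ?_⟩
    filter_upwards [Lp.coeFn_add f g, hfF, hgG] with ω h1 h2 h3
    rw [h1, Pi.add_apply, add_smul, h2, h3, Pi.add_apply]
  | smul c f _ hf =>
    obtain ⟨F, hF, hfF⟩ := hf
    refine ⟨c • F, Submodule.smul_mem _ c hF, ?_⟩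
    filter_upwards [Lp.coeFn_smul c f, hfF] with ω h1 h2
    rw [h1, Pi.smul_apply, smul_assoc, h2, Pi.smul_apply]

theorem exists_sum_mem_elementaryChaos {H : Type*} [NormedAddCommGroup H] [InnerProductSpace ℝ H]
    {Ω : Type*} [MeasurableSpace Ω] {P : Measure Ω} {W : H → Ω → ℝ} {n : ℕ}
    {X : Type*} [NormedAddCommGroup X] [NormedSpace ℝ X] {ι : Type*} [Fintype ι]
    {f : ι → Lp ℝ 2 P}
    (hf : ∀ j, f j ∈ Submodule.span ℝ
      {f : Lp ℝ 2 P | ∃ h : H, ‖h‖ = 1 ∧ ∀ᵐ ω ∂P, f ω = hermiteFun n (W h ω)}) (x : ι → X) :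
    ∃ F ∈ elementaryChaos W n X, (fun ω => ∑ j, f j ω • x j) =ᵐ[P] F := by
  choose F hF hfF using fun j => exists_mem_elementaryChaos (hf j) (x j)
  refine ⟨∑ j, F j, sum_mem fun j _ => hF j, ?_⟩
  filter_upwards [ae_all_iff.2 hfF] with ω hω
  simp [hω]

/-- Hypercontractivity on the Wiener chaos, from `L²` to `L^{2k}`. -/
theorem IsIsonormal.eLpNorm_le_of_mem_wienerChaos {H : Type*} [NormedAddCommGroup H]
    [InnerProductSpace ℝ H] {Ω : Type*} [MeasurableSpace Ω] {P : Measure Ω}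
    [IsProbabilityMeasure P] {W : H → Ω → ℝ} (hW : IsIsonormal P W)
    {X : Type*} [NormedAddCommGroup X] [NormedSpace ℝ X] [CompleteSpace X]
    {ρ : ℝ} (hρ : 0 < ρ) (hρ' : ρ ^ 2 < 1) {k : ℕ} (hk : k ≠ 0)
    (hγ : IsHypercontractive (gaussianReal 0 1) ρ (√(1 - ρ ^ 2)) k) (n : ℕ)
    {ι : Type*} [Fintype ι] {ξ : ι → Lp ℝ 2 P} (hξ : ∀ j, ξ j ∈ wienerChaos P W n) (x : ι → X) :
    eLpNorm (fun ω => ∑ j, ξ j ω • x j) (2 * k : ℕ) P ≤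
      ENNReal.ofReal ((ρ ^ n)⁻¹) * eLpNorm (fun ω => ∑ j, ξ j ω • x j) 2 P := by
  choose f hf hfξ using fun j => mem_closure_iff_seq_limit.1 (hξ j)
  have hmeas : ∀ g : ι → Lp ℝ 2 P, AEStronglyMeasurable (fun ω => ∑ j, g j ω • x j) P := fun g =>
    Finset.aestronglyMeasurable_fun_sum _ fun j _ => (Lp.aestronglyMeasurable (g j)).smul_const _
  have hbound : ∀ N, eLpNorm (fun ω => ∑ j, f j N ω • x j) (2 * k : ℕ) P ≤
      ENNReal.ofReal ((ρ ^ n)⁻¹) * eLpNorm (fun ω => ∑ j, f j N ω • x j) 2 P := fun N => by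
    obtain ⟨F, hF, hfF⟩ := exists_sum_mem_elementaryChaos (fun j => hf j N) x
    rw [eLpNorm_congr_ae hfF, eLpNorm_congr_ae hfF]
    exact hW.eLpNorm_le_of_mem_elementaryChaos hρ hρ' hk hγ n hF
  have hdiff : Tendsto (fun N => eLpNorm ((fun ω => ∑ j, f j N ω • x j) -
      fun ω => ∑ j, ξ j ω • x j) 2 P) atTop (nhds 0) := by
    have hle : ∀ N, eLpNorm ((fun ω => ∑ j, f j N ω • x j) - fun ω => ∑ j, ξ j ω • x j) 2 P ≤
        ∑ j, ENNReal.ofReal ‖x j‖ * eLpNorm (⇑(f j N) - ⇑(ξ j)) 2 P := fun N => by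
      have e : ((fun ω => ∑ j, f j N ω • x j) - fun ω => ∑ j, ξ j ω • x j) =
          ∑ j, fun ω => (⇑(f j N) - ⇑(ξ j)) ω • x j := by
        ext ω
        simp [sub_smul]
      rw [e]
      refine (eLpNorm_sum_le (fun j _ => ?_) one_le_two).trans (Finset.sum_le_sum fun j _ => ?_)
      · exact ((Lp.aestronglyMeasurable _).sub (Lp.aestronglyMeasurable _)).smul_const _
      · refine eLpNorm_le_mul_eLpNorm_of_ae_le_mul (ae_of_all _ fun ω => ?_) 2
        rw [norm_smul, mul_comm]
    refine tendsto_of_tendsto_of_tendsto_of_le_of_le tendsto_const_nhds ?_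
      (fun _ => zero_le) hle
    have hsum := tendsto_finsetSum Finset.univ fun j _ =>
      ENNReal.Tendsto.const_mul (a := ENNReal.ofReal ‖x j‖)
        ((Lp.tendsto_Lp_iff_tendsto_eLpNorm' _ _).1 (hfξ j)) (Or.inr ENNReal.ofReal_ne_top)
    simpa using hsum
  obtain ⟨ns, hns, hae⟩ := (tendstoInMeasure_of_tendsto_eLpNorm two_ne_zero (fun N => hmeas _)
    (hmeas _) hdiff).exists_seq_tendsto_ae
  have hfatou := Lp.eLpNorm_lim_le_liminf_eLpNorm (p := (2 * k : ℕ))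
    (fun N => hmeas fun j => f j (ns N)) _ hae
  refine hfatou.trans ?_
  have hlim : Tendsto (fun N => ENNReal.ofReal ((ρ ^ n)⁻¹) *
      (eLpNorm ((fun ω => ∑ j, f j (ns N) ω • x j) - fun ω => ∑ j, ξ j ω • x j) 2 P +
      eLpNorm (fun ω => ∑ j, ξ j ω • x j) 2 P)) atTop
      (nhds (ENNReal.ofReal ((ρ ^ n)⁻¹) * (0 + eLpNorm (fun ω => ∑ j, ξ j ω • x j) 2 P))) :=
    ENNReal.Tendsto.const_mul ((hdiff.comp hns.tendsto_atTop).add tendsto_const_nhds)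
      (Or.inr ENNReal.ofReal_ne_top)
  rw [zero_add] at hlim
  refine (liminf_le_liminf (Eventually.of_forall fun N => ?_)).trans hlim.liminf_eq.le
  refine (hbound _).trans ?_
  gcongr
  refine le_trans (le_of_eq ?_) (eLpNorm_add_le ((hmeas _).sub (hmeas _)) (hmeas _) one_le_two)
  rw [sub_add_cancel]

/-- If the fourth moment of `F` is controlled by its second moment, the second moment is
controlled by the first. -/
theorem eLpNorm_two_le_of_eLpNorm_four_le {Ω X : Type*} [MeasurableSpace Ω]
    [NormedAddCommGroup X] {P : Measure Ω} {F : Ω → X} (hF : MemLp F 2 P) {C : ℝ≥0∞}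
    (h : eLpNorm F 4 P ≤ C * eLpNorm F 2 P) :
    eLpNorm F 2 P ≤ C ^ 2 * eLpNorm F 1 P := by
  set M := eLpNorm F 2 P with hM
  have h1 : eLpNorm F 1 P = ∫⁻ ω, ‖F ω‖ₑ ∂P := eLpNorm_one_eq_lintegral_enorm
  have h2 : M ^ 2 = ∫⁻ ω, ‖F ω‖ₑ ^ 2 ∂P := by
    rw [hM, eLpNorm_eq_lintegral_rpow_enorm_toReal (by simp) (by simp), ← ENNReal.rpow_natCast,
      ← ENNReal.rpow_mul]
    simp
  have h4 : eLpNorm F 4 P ^ 4 = ∫⁻ ω, ‖F ω‖ₑ ^ 4 ∂P := by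
    rw [eLpNorm_eq_lintegral_rpow_enorm_toReal (by simp) (by simp), ← ENNReal.rpow_natCast,
      ← ENNReal.rpow_mul]
    simp
  have hm : AEMeasurable (fun ω => ‖F ω‖ₑ) P := hF.1.enorm
  have hol := ENNReal.lintegral_mul_norm_pow_le hm (hm.pow_const 4)
    (p := 2 / 3) (q := 1 / 3) (by norm_num) (by norm_num) (by norm_num)
  have e : ∀ ω, ‖F ω‖ₑ ^ (2 / 3 : ℝ) * (‖F ω‖ₑ ^ 4) ^ (1 / 3 : ℝ) = ‖F ω‖ₑ ^ 2 := fun ω => by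
    rw [← ENNReal.rpow_natCast, ← ENNReal.rpow_mul, ← ENNReal.rpow_add_of_nonneg _ _
      (by norm_num) (by norm_num), ← ENNReal.rpow_natCast]
    norm_num
  simp_rw [e] at hol
  rw [← h1, ← h2, ← h4] at hol
  have hcube : (M ^ 2) ^ 3 ≤ eLpNorm F 1 P ^ 2 * eLpNorm F 4 P ^ 4 := by
    refine (pow_le_pow_left' hol 3).trans (le_of_eq ?_)
    rw [mul_pow]
    simp only [← ENNReal.rpow_natCast, ← ENNReal.rpow_mul]
    norm_num
  rcases eq_or_ne M 0 with h0 | h0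
  · simp [h0]
  have hfin : M ≠ ∞ := hF.2.ne
  have hsq : M ^ 4 * M ^ 2 ≤ M ^ 4 * (C ^ 2 * eLpNorm F 1 P) ^ 2 := by
    calc M ^ 4 * M ^ 2 = (M ^ 2) ^ 3 := by ring
      _ ≤ eLpNorm F 1 P ^ 2 * eLpNorm F 4 P ^ 4 := hcube
      _ ≤ eLpNorm F 1 P ^ 2 * (C * M) ^ 4 := by gcongr
      _ = _ := by ring
  rw [ENNReal.mul_le_mul_iff_right (by positivity) (by finiteness)] at hsq
  exact (ENNReal.pow_le_pow_left_iff two_ne_zero).1 hsq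

/-- Hypercontractivity / equivalence of moments on a fixed Wiener chaos, for Banach-space
valued linear combinations: for `p, q ∈ [1, ∞)` and `n ≥ 0` there is a constant `C` such that
for every Banach space `X`, every `ξ₁, …, ξ_m` in the `n`-th Wiener chaos and every
`x₁, …, x_m ∈ X`,
`‖Σ ξ_j • x_j‖_{L^q(Ω;X)} ≤ C ‖Σ ξ_j • x_j‖_{L^p(Ω;X)}`. -/
theorem hypercontractivity_wiener_chaos
    {H : Type*} [NormedAddCommGroup H] [InnerProductSpace ℝ H]
    {Ω : Type*} [MeasurableSpace Ω] (P : Measure Ω) [IsProbabilityMeasure P]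
    (W : H → Ω → ℝ) (hW : IsIsonormal P W)
    (p q : ℝ≥0∞) (hp : 1 ≤ p) (hp' : p ≠ ∞) (hq : 1 ≤ q) (hq' : q ≠ ∞) (n : ℕ) :
    ∃ C : ℝ≥0, ∀ (X : Type) (_ : NormedAddCommGroup X) (_ : NormedSpace ℝ X)
      (_ : CompleteSpace X) (m : ℕ) (ξ : Fin m → Lp ℝ 2 P) (x : Fin m → X),
      (∀ j, ξ j ∈ wienerChaos P W n) →
      eLpNorm (fun ω => ∑ j, (ξ j : Ω → ℝ) ω • x j) q P ≤
        C * eLpNorm (fun ω => ∑ j, (ξ j : Ω → ℝ) ω • x j) p P := by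
  obtain ⟨ρ, hρ, hρ', hγ⟩ := exists_isHypercontractive_gaussianReal 1
  obtain ⟨i, hi⟩ := exists_nat_ge q.toReal
  obtain ⟨r, hr, hr', hγr⟩ := exists_isHypercontractive_gaussianReal i
  refine ⟨((r ^ n)⁻¹).toNNReal * ((ρ ^ n)⁻¹).toNNReal ^ 2, fun X _ _ _ m ξ x hξ => ?_⟩
  set F : Ω → X := fun ω => ∑ j, (ξ j : Ω → ℝ) ω • x j with hFdef
  have hF : MemLp F 2 P := memLp_finsetSum _ fun j _ => 
    (ContinuousLinearMap.toSpanSingleton ℝ (x j)).comp_memLp' (Lp.memLp (ξ j))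
  have h4 : eLpNorm F 4 P ≤ ENNReal.ofReal ((ρ ^ n)⁻¹) * eLpNorm F 2 P := by
    simpa using hW.eLpNorm_le_of_mem_wienerChaos hρ hρ' two_ne_zero hγ n hξ x
  have hqi : q ≤ (2 * (i + 1) : ℕ) := by
    rw [← ENNReal.ofReal_toReal hq', ← ENNReal.ofReal_natCast]
    refine ENNReal.ofReal_le_ofReal ?_
    push_cast
    linarith [i.cast_nonneg (α := ℝ)]
  calc eLpNorm F q P ≤ eLpNorm F (2 * (i + 1) : ℕ) P :=
        eLpNorm_le_eLpNorm_of_exponent_le hqi hF.1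
    _ ≤ ENNReal.ofReal ((r ^ n)⁻¹) * eLpNorm F 2 P :=
        hW.eLpNorm_le_of_mem_wienerChaos hr hr' i.succ_ne_zero hγr n hξ x
    _ ≤ ENNReal.ofReal ((r ^ n)⁻¹) * (ENNReal.ofReal ((ρ ^ n)⁻¹) ^ 2 * eLpNorm F p P) := by
        gcongr
        refine (eLpNorm_two_le_of_eLpNorm_four_le hF h4).trans ?_
        gcongr
        exact eLpNorm_le_eLpNorm_of_exponent_le hp hF.1
    _ = _ := by
        rw [← mul_assoc]
        simp [ENNReal.ofReal]
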